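/- arXiv:2406.04126 — 2 statements merged into one kernel-verified Lean document; each statement's English description precedes it below -/
import Mathlib

section
/- Under the admissibility hypotheses (proper admissibility of the pairs (ℓ^1_{β,0}, ℓ^∞_{β,Z}) and (ℓ^1_{-β,0}, ℓ^∞_{-β,Z})), define S(n) = {v ∈ X : sup_{m≥n} ‖𝒜(m,n)v‖ < ∞} and U(n) = 𝒜(n,0)Z. Then X = S(n) ⊕ U(n) for every n ∈ ℕ. -/
/-- A sequence that agrees with `𝒜 · n w` at time `k` and solves the homogeneous equation from time
`k` on agrees with it at all later times. -/
theorem evolution_apply_eq_of_solution {X : Type*} [NormedAddCommGroup X] [NormedSpace ℝ X]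
    {A : ℕ → X →L[ℝ] X} {𝒜 : ℕ → ℕ → X →L[ℝ] X}
    (h𝒜succ : ∀ m n, n ≤ m → 𝒜 (m + 1) n = (A m).comp (𝒜 m n))
    {n k : ℕ} (hnk : n ≤ k) {w : X} {x : ℕ → X} (hk : x k = 𝒜 k n w) {l : ℕ}
    (hx : ∀ m, k ≤ m → m < l → x (m + 1) = A m (x m)) {m : ℕ} (hkm : k ≤ m) (hml : m ≤ l) :
    x m = 𝒜 m n w := by
  induction m, hkm using Nat.le_induction with
  | base => exact hk
  | succ m hkm ih =>
    rw [hx m hkm (by omega), ih (by omega), h𝒜succ m n (hnk.trans hkm)]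
    rfl

/-- An eventually bounded family of norms is bounded. -/
theorem exists_norm_bound_of_ge {X : Type*} [NormedAddCommGroup X] (f : ℕ → X) (k : ℕ) {C : ℝ}
    (h : ∀ m, k ≤ m → ‖f m‖ ≤ C) : ∃ D, ∀ m, ‖f m‖ ≤ D := by
  have hs : ∀ m, 0 ≤ ∑ i ∈ Finset.range m, ‖f i‖ := fun m =>
    Finset.sum_nonneg fun i _ => norm_nonneg (f i)
  refine ⟨|C| + ∑ i ∈ Finset.range k, ‖f i‖, fun m => ?_⟩
  rcases le_or_gt k m with hm | hm
  · linarith [h m hm, le_abs_self C, hs k]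
  · have := Finset.single_le_sum (fun i _ => norm_nonneg (f i)) (Finset.mem_range.2 hm)
    linarith [abs_nonneg C]

/-- Splitting lemma: under proper admissibility of `(ℓ^1_{β,0}, ℓ^∞_{β,Z})`
and `(ℓ^1_{-β,0}, ℓ^∞_{-β,Z})`, setting
`S(n) = {v : sup_{m≥n} ‖𝒜(m,n)v‖ < ∞}` and `U(n) = 𝒜(n,0)Z`, one has
`X = S(n) ⊕ U(n)` for every `n ∈ ℕ`. -/
theorem stmt6 {X : Type*} [NormedAddCommGroup X] [NormedSpace ℝ X] [CompleteSpace X]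
    (μ : ℕ → ℝ) (hμpos : ∀ n, 0 < μ n) (hμmono : StrictMono μ)
    (hμtop : Filter.Tendsto μ Filter.atTop Filter.atTop)
    (ν : ℕ → ℝ) (hν : ∀ n, 1 ≤ ν n)
    (A : ℕ → X →L[ℝ] X) (𝒜 : ℕ → ℕ → X →L[ℝ] X)
    (h𝒜id : ∀ n, 𝒜 n n = 1)
    (h𝒜succ : ∀ m n, n ≤ m → 𝒜 (m + 1) n = (A m).comp (𝒜 m n))
    (Z : Submodule ℝ X) (hZ : IsClosed (Z : Set X))
    (β : ℝ) (hβ : 0 < β)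
    (hadm₁ : ∀ y : ℕ → X, y 0 = 0 → Summable (fun n => μ n ^ β * ν n * ‖y n‖) →
      ∃! x : ℕ → X, x 0 ∈ Z ∧ (∃ C, ∀ n, μ n ^ β * ‖x n‖ ≤ C) ∧
        ∀ n, x (n + 1) - A n (x n) = y (n + 1))
    (hadm₂ : ∀ y : ℕ → X, y 0 = 0 → Summable (fun n => μ n ^ (-β) * ν n * ‖y n‖) →
      ∃! x : ℕ → X, x 0 ∈ Z ∧ (∃ C, ∀ n, μ n ^ (-β) * ‖x n‖ ≤ C) ∧
        ∀ n, x (n + 1) - A n (x n) = y (n + 1))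
    (S U : ℕ → Set X)
    (hSdef : ∀ n, S n = {v : X | ∃ C, ∀ m, n ≤ m → ‖𝒜 m n v‖ ≤ C})
    (hUdef : ∀ n, U n = (𝒜 n 0) '' (Z : Set X)) :
    ∀ n, ∀ v : X, ∃! p : X × X, p.1 ∈ S n ∧ p.2 ∈ U n ∧ v = p.1 + p.2 := by
  intro n v
  have hcocycle : ∀ z m, n ≤ m → 𝒜 m 0 z = 𝒜 m n (𝒜 n 0 z) := fun z m hm =>
    evolution_apply_eq_of_solution h𝒜succ (x := fun m => 𝒜 m 0 z) le_rfl (by simp [h𝒜id])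
      (l := m) (fun j _ _ => by simp [h𝒜succ j 0 (Nat.zero_le j)]) hm le_rfl
  have hdisjoint : ∀ z ∈ Z, (∃ C, ∀ m, n ≤ m → ‖𝒜 m n (𝒜 n 0 z)‖ ≤ C) → z = 0 := by
    rintro z hz ⟨C, hC⟩
    obtain ⟨D, hD⟩ := exists_norm_bound_of_ge (fun m => 𝒜 m 0 z) n (C := C)
      fun m hm => by rw [hcocycle z m hm]; exact hC m hm
    have hunique := (hadm₂ 0 rfl (by simp [summable_zero])).unique
      (y₁ := fun m => 𝒜 m 0 z) (y₂ := 0)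
      ⟨by simpa [h𝒜id] using hz, ⟨μ 0 ^ (-β) * D, fun m => ?_⟩,
        fun m => by simp [h𝒜succ m 0 (Nat.zero_le m)]⟩
      ⟨Z.zero_mem, ⟨0, by simp⟩, by simp⟩
    · simpa [h𝒜id] using congrFun hunique 0
    · exact mul_le_mul
        (Real.rpow_le_rpow_of_nonpos (hμpos 0) (hμmono.monotone (Nat.zero_le m)) (by linarith))
        (hD m) (norm_nonneg _) (Real.rpow_nonneg (hμpos 0).le _)
  obtain ⟨x, ⟨hx0, ⟨C, hC⟩, hx⟩, -⟩ := hadm₁ (Pi.single (n + 1) (A n v))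
    (Pi.single_eq_of_ne (by omega) _)
    (summable_of_ne_finset_zero (s := {n + 1}) fun m hm => by
      rw [Pi.single_eq_of_ne (by simpa using hm)]; simp)
  have hhom : ∀ m, m ≠ n → x (m + 1) = A m (x m) := fun m hm => by
    rw [← sub_eq_zero, hx m, Pi.single_eq_of_ne (by omega)]
  have hxn : x n = 𝒜 n 0 (x 0) :=
    evolution_apply_eq_of_solution h𝒜succ le_rfl (by simp [h𝒜id]) (l := n)
      (fun m _ hm => hhom m hm.ne) (Nat.zero_le n) le_rfl
  have hxsucc : x (n + 1) = 𝒜 (n + 1) n (v + x n) := by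
    have h := hx n
    rw [Pi.single_eq_same, sub_eq_iff_eq_add] at h
    simp [h, h𝒜succ n n le_rfl, h𝒜id]
  have hstable : ∃ D, ∀ m, n ≤ m → ‖𝒜 m n (v + x n)‖ ≤ D := by
    obtain ⟨D, hD⟩ := exists_norm_bound_of_ge (fun m => 𝒜 m n (v + x n)) (n + 1)
      (C := C / μ 0 ^ β) fun m hm => by
        rw [← evolution_apply_eq_of_solution h𝒜succ n.le_succ hxsucc (l := m)
          (fun j hj _ => hhom j (by omega)) hm le_rfl,
          le_div_iff₀' (Real.rpow_pos_of_pos (hμpos 0) β)]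
        refine le_trans (mul_le_mul_of_nonneg_right ?_ (norm_nonneg _)) (hC m)
        exact Real.rpow_le_rpow (hμpos 0).le (hμmono.monotone (Nat.zero_le m)) hβ.le
    exact ⟨D, fun m _ => hD m⟩
  simp only [hSdef, hUdef]
  refine ⟨(v + x n, -x n), ⟨hstable, ⟨-x 0, Z.neg_mem hx0, by simp [hxn]⟩, by simp⟩, ?_⟩
  rintro ⟨s, _⟩ ⟨⟨C₁, hC₁⟩, ⟨z, hz, rfl⟩, hv⟩
  obtain ⟨C₂, hC₂⟩ := hstable
  have hs : 𝒜 n 0 (z + x 0) = v + x n - s := by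
    rw [map_add, ← hxn, show v = s + 𝒜 n 0 z from hv]
    abel
  have hzero : z + x 0 = 0 := hdisjoint _ (Z.add_mem hz hx0) ⟨C₂ + C₁, fun m hm => by
    rw [hs, map_sub]
    exact (norm_sub_le _ _).trans (add_le_add (hC₂ m hm) (hC₁ m hm))⟩
  rw [hzero, map_zero, eq_comm, sub_eq_zero] at hs
  refine Prod.ext hs.symm ?_
  simp [eq_neg_of_add_eq_zero_left hzero, hxn]
end

section
/- Under the admissibility hypotheses, there exists C > 0 such that ‖𝒜(m,n)v‖ ≤ C (μ_m/μ_n)^{-β} ν_n ‖v‖ for every m ≥ n ≥ 0 and every v ∈ S(n) = {w : sup_{k≥n}‖𝒜(k,n)w‖ < ∞}. -/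
open Filter Topology
open scoped ENNReal

/-- `x` solves `x (n + 1) - A n (x n) = y n` with `x 0 ∈ Z` and `a n * ‖x n‖` bounded. -/
structure IsWeightedSolution {X : Type*} [NormedAddCommGroup X] [NormedSpace ℝ X]
    (A : ℕ → X →L[ℝ] X) (Z : Submodule ℝ X) (a : ℕ → ℝ) (y x : ℕ → X) : Prop where
  zero_mem : x 0 ∈ Z
  bounded : ∃ C, ∀ n, a n * ‖x n‖ ≤ C
  eq : ∀ n, x (n + 1) - A n (x n) = y n

namespace IsWeightedSolution

variable {X : Type*} [NormedAddCommGroup X] [NormedSpace ℝ X]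
  {A : ℕ → X →L[ℝ] X} {Z : Submodule ℝ X} {a : ℕ → ℝ} {y y' x x' : ℕ → X}

theorem add (ha : ∀ n, 0 < a n) (h : IsWeightedSolution A Z a y x)
    (h' : IsWeightedSolution A Z a y' x') : IsWeightedSolution A Z a (y + y') (x + x') := by
  obtain ⟨C, hC⟩ := h.bounded
  obtain ⟨C', hC'⟩ := h'.bounded
  refine ⟨Z.add_mem h.zero_mem h'.zero_mem, ⟨C + C', fun n => ?_⟩, fun n => ?_⟩
  · calc a n * ‖x n + x' n‖ ≤ a n * (‖x n‖ + ‖x' n‖) :=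
          mul_le_mul_of_nonneg_left (norm_add_le _ _) (ha n).le
      _ ≤ C + C' := by rw [mul_add]; exact add_le_add (hC n) (hC' n)
  · simp only [Pi.add_apply, map_add, ← h.eq n, ← h'.eq n]
    abel

theorem smul (c : ℝ) (h : IsWeightedSolution A Z a y x) :
    IsWeightedSolution A Z a (c • y) (c • x) := by
  obtain ⟨C, hC⟩ := h.bounded
  refine ⟨Z.smul_mem c h.zero_mem, ⟨|c| * C, fun n => ?_⟩, fun n => ?_⟩
  · calc a n * ‖c • x n‖ = |c| * (a n * ‖x n‖) := by rw [norm_smul, Real.norm_eq_abs]; ring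
      _ ≤ |c| * C := mul_le_mul_of_nonneg_left (hC n) (abs_nonneg c)
  · simp only [Pi.smul_apply, map_smul, ← h.eq n, smul_sub]

/-- Unique solvability for all weighted-summable inhomogeneities gives, by the closed graph
theorem, a uniform bound for the solutions driven by a single impulse. -/
theorem exists_impulse_bound [CompleteSpace X] (hZ : IsClosed (Z : Set X)) {w : ℕ → ℝ}
    (ha : ∀ n, 0 < a n) (hw : ∀ n, 0 < w n)
    (hadm : ∀ y : ℕ → X, Summable (fun n => w n * ‖y n‖) → ∃! x, IsWeightedSolution A Z a y x) :
    ∃ K : ℝ, 0 ≤ K ∧ ∀ (n : ℕ) (v : X) (x : ℕ → X),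
      IsWeightedSolution A Z a (Pi.single n v) x → ∀ m, a m * ‖x m‖ ≤ K * (w n * ‖v‖) := by
  let Y : lp (fun _ : ℕ => X) 1 → ℕ → X := fun u n => (w n)⁻¹ • u n
  have hY : ∀ u, Summable (fun n => w n * ‖Y u n‖) := by
    intro u
    have hu := (lp.memℓp u).summable (by simp)
    refine hu.congr fun n => ?_
    have := (hw n).ne'
    simp [Y, norm_smul, abs_of_pos (hw n), this]
  choose F hF hFuniq using fun u => hadm (Y u) (hY u)
  have hmem : ∀ u, Memℓp (fun n => a n • F u n : ℕ → X) ∞ := by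
    intro u
    obtain ⟨C, hC⟩ := (hF u).bounded
    refine memℓp_infty ⟨C, ?_⟩
    rintro _ ⟨n, rfl⟩
    simpa [norm_smul, abs_of_pos (ha n)] using hC n
  have hFadd : ∀ u u', F (u + u') = F u + F u' := fun u u' =>
    ((hFuniq (u + u')) _ (by
      have := (hF u).add ha (hF u')
      convert this using 1
      ext n
      simp [Y])).symm
  have hFsmul : ∀ (c : ℝ) u, F (c • u) = c • F u := fun c u =>
    ((hFuniq (c • u)) _ (by
      have := (hF u).smul c
      convert this using 1
      ext n
      simp [Y, smul_comm c])).symm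
  let T : lp (fun _ : ℕ => X) 1 →ₗ[ℝ] lp (fun _ : ℕ => X) ∞ :=
    { toFun := fun u => ⟨fun n => a n • F u n, hmem u⟩
      map_add' := fun u u' => by
        ext n
        simp only [hFadd, Pi.add_apply, smul_add]
        rfl
      map_smul' := fun c u => by
        ext n
        simp [hFsmul, smul_comm c] }
  have hT : ∀ u n, T u n = a n • F u n := fun _ _ => rfl
  have hcont : Continuous T := by
    refine T.continuous_of_seq_closed_graph fun u u₀ z hu hz => ?_
    have hucoord : ∀ n, Tendsto (fun k => u k n) atTop (𝓝 (u₀ n)) := fun n =>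
      ((lp.evalCLM ℝ (fun _ : ℕ => X) 1 n).continuous.tendsto u₀).comp hu
    have hzcoord : ∀ n, Tendsto (fun k => F (u k) n) atTop (𝓝 ((a n)⁻¹ • z n)) := by
      intro n
      have h1 : Tendsto (fun k => T (u k) n) atTop (𝓝 (z n)) :=
        ((lp.evalCLM ℝ (fun _ : ℕ => X) ∞ n).continuous.tendsto z).comp hz
      refine (h1.const_smul (a n)⁻¹).congr fun k => ?_
      rw [hT, inv_smul_smul₀ (ha n).ne']
    have hsol : IsWeightedSolution A Z a (Y u₀) (fun n => (a n)⁻¹ • z n) := by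
      refine ⟨?_, ⟨‖z‖, fun n => ?_⟩, fun n => ?_⟩
      · exact hZ.mem_of_tendsto (hzcoord 0) (Eventually.of_forall fun k => (hF (u k)).zero_mem)
      · rw [norm_smul, norm_inv, Real.norm_eq_abs, abs_of_pos (ha n),
          mul_inv_cancel_left₀ (ha n).ne']
        exact lp.norm_apply_le_norm (by simp) z n
      · refine tendsto_nhds_unique ((hzcoord (n + 1)).sub
          (((A n).continuous.tendsto _).comp (hzcoord n))) ?_
        refine ((hucoord n).const_smul (w n)⁻¹).congr fun k => ?_
        exact ((hF (u k)).eq n).symm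
    ext n
    rw [hT, ← hFuniq u₀ _ hsol, smul_inv_smul₀ (ha n).ne']
  let S : lp (fun _ : ℕ => X) 1 →L[ℝ] lp (fun _ : ℕ => X) ∞ := ⟨T, hcont⟩
  refine ⟨‖S‖, norm_nonneg _, fun n v x hx m => ?_⟩
  have hYsingle : Y (lp.single 1 n (w n • v)) = Pi.single n v := by
    ext k
    obtain rfl | hk := eq_or_ne k n
    · simp [Y, (hw k).ne']
    · simp [Y, hk]
  have hxF : x = F (lp.single 1 n (w n • v)) := hFuniq _ _ (by rw [hYsingle]; exact hx)
  calc a m * ‖x m‖ = ‖S (lp.single 1 n (w n • v)) m‖ := by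
        change _ = ‖a m • F _ m‖
        rw [norm_smul, Real.norm_eq_abs, abs_of_pos (ha m), hxF]
    _ ≤ ‖S (lp.single 1 n (w n • v))‖ := lp.norm_apply_le_norm (by simp) _ m
    _ ≤ ‖S‖ * ‖lp.single (E := fun _ : ℕ => X) 1 n (w n • v)‖ := S.le_opNorm _
    _ = ‖S‖ * (w n * ‖v‖) := by
        rw [lp.norm_single one_pos, norm_smul, Real.norm_eq_abs, abs_of_pos (hw n)]

/-- Admissibility for sequences vanishing at `0`, restated for the shifted inhomogeneity. -/
theorem existsUnique_of_admissible {w : ℕ → ℝ}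
    (hadm : ∀ y : ℕ → X, y 0 = 0 → Summable (fun n => w n * ‖y n‖) →
      ∃! x : ℕ → X, x 0 ∈ Z ∧ (∃ C, ∀ n, a n * ‖x n‖ ≤ C) ∧
        ∀ n, x (n + 1) - A n (x n) = y (n + 1))
    (y : ℕ → X) (hy : Summable (fun n => w (n + 1) * ‖y n‖)) :
    ∃! x, IsWeightedSolution A Z a y x := by
  let y₀ : ℕ → X := fun n => Nat.casesOn n 0 y
  have hy₀ : Summable (fun n => w n * ‖y₀ n‖) :=
    (summable_nat_add_iff (f := fun n => w n * ‖y₀ n‖) 1).1 hy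
  obtain ⟨x, ⟨h0, hb, he⟩, huniq⟩ := hadm y₀ rfl hy₀
  exact ⟨x, ⟨h0, hb, he⟩, fun x' h' => huniq x' ⟨h'.zero_mem, h'.bounded, h'.eq⟩⟩

end IsWeightedSolution

/-- Under the admissibility hypotheses, there exists `C > 0` such that
`‖𝒜(m,n)v‖ ≤ C (μ_m/μ_n)^{-β} ν_n ‖v‖` for all `m ≥ n` and all `v ∈ S(n)`,
where `S(n) = {w : sup_{k≥n} ‖𝒜(k,n)w‖ < ∞}`. -/
theorem stmt10 {X : Type*} [NormedAddCommGroup X] [NormedSpace ℝ X] [CompleteSpace X]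
    (μ : ℕ → ℝ) (hμpos : ∀ n, 0 < μ n) (hμmono : StrictMono μ)
    (hμtop : Filter.Tendsto μ Filter.atTop Filter.atTop)
    (ν : ℕ → ℝ) (hν : ∀ n, 1 ≤ ν n)
    (A : ℕ → X →L[ℝ] X) (𝒜 : ℕ → ℕ → X →L[ℝ] X)
    (h𝒜id : ∀ n, 𝒜 n n = 1)
    (h𝒜succ : ∀ m n, n ≤ m → 𝒜 (m + 1) n = (A m).comp (𝒜 m n))
    (Z : Submodule ℝ X) (hZ : IsClosed (Z : Set X))
    (β : ℝ) (hβ : 0 < β)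
    (hadm₁ : ∀ y : ℕ → X, y 0 = 0 → Summable (fun n => μ n ^ β * ν n * ‖y n‖) →
      ∃! x : ℕ → X, x 0 ∈ Z ∧ (∃ C, ∀ n, μ n ^ β * ‖x n‖ ≤ C) ∧
        ∀ n, x (n + 1) - A n (x n) = y (n + 1))
    (hadm₂ : ∀ y : ℕ → X, y 0 = 0 → Summable (fun n => μ n ^ (-β) * ν n * ‖y n‖) →
      ∃! x : ℕ → X, x 0 ∈ Z ∧ (∃ C, ∀ n, μ n ^ (-β) * ‖x n‖ ≤ C) ∧
        ∀ n, x (n + 1) - A n (x n) = y (n + 1)) :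
    ∃ C > (0 : ℝ), ∀ m n, n ≤ m → ∀ v : X,
      (∃ C', ∀ k, n ≤ k → ‖𝒜 k n v‖ ≤ C') →
      ‖𝒜 m n v‖ ≤ C * (μ m / μ n) ^ (-β) * ν n * ‖v‖ := by
  have hadm₁' := IsWeightedSolution.existsUnique_of_admissible hadm₁
  have hadm₂' := IsWeightedSolution.existsUnique_of_admissible hadm₂
  have hpow : ∀ (s : ℝ) n, 0 < μ n ^ s := fun s n => Real.rpow_pos_of_pos (hμpos n) s
  have hνpos : ∀ n, 0 < ν n := fun n => zero_lt_one.trans_le (hν n)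
  have hanti : ∀ n, μ n ^ (-β) ≤ μ 0 ^ (-β) := fun n =>
    Real.rpow_le_rpow_of_nonpos (hμpos 0) (hμmono.monotone (Nat.zero_le n)) (by linarith)
  obtain ⟨K, hK, hbound⟩ := IsWeightedSolution.exists_impulse_bound (A := A) hZ
    (hpow β) (fun n => mul_pos (hpow β (n + 1)) (hνpos (n + 1))) hadm₁'
  have hdiv : ∀ m n, (μ m / μ n) ^ (-β) = μ n ^ β / μ m ^ β := fun m n => by
    rw [Real.rpow_neg (div_nonneg (hμpos m).le (hμpos n).le),
      Real.div_rpow (hμpos m).le (hμpos n).le, inv_div]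
  -- Starting times `n + 1`: the trajectory is the solution driven by an impulse.
  have hsucc : ∀ m n, n + 1 ≤ m → ∀ v : X, (∃ C', ∀ k, n + 1 ≤ k → ‖𝒜 k (n + 1) v‖ ≤ C') →
      ‖𝒜 m (n + 1) v‖ ≤ K * (μ m / μ (n + 1)) ^ (-β) * ν (n + 1) * ‖v‖ := by
    rintro m n hm v ⟨C', hC'⟩
    let z : ℕ → X := fun k => if n + 1 ≤ k then 𝒜 k (n + 1) v else 0
    have hz : IsWeightedSolution A Z (fun k => μ k ^ (-β)) (Pi.single n v) z := by
      have hC'0 : 0 ≤ C' := (norm_nonneg _).trans (hC' _ le_rfl)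
      refine ⟨by simp [z], ⟨μ 0 ^ (-β) * C', fun k => ?_⟩, fun k => ?_⟩
      · refine mul_le_mul (hanti k) ?_ (norm_nonneg _) (hpow _ _).le
        by_cases hk : n + 1 ≤ k
        · simpa only [z, hk, if_true] using hC' k hk
        · simpa only [z, hk, if_false, norm_zero] using hC'0
      · rcases lt_trichotomy k n with hk | rfl | hk
        · have h1 : ¬ n + 1 ≤ k + 1 := by omega
          have h2 : ¬ n + 1 ≤ k := by omega
          simp only [z, h1, h2, if_false, map_zero, sub_zero]
          simp [hk.ne]
        · simp [z, h𝒜id]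
        · have h1 : n + 1 ≤ k + 1 := by omega
          have h2 : n + 1 ≤ k := hk
          simp only [z, h1, h2, if_true, h𝒜succ k (n + 1) h2]
          simp [hk.ne']
    have hsum : ∀ s : ℝ, Summable
        (fun k => μ (k + 1) ^ s * ν (k + 1) * ‖(Pi.single n v : ℕ → X) k‖) := fun s =>
      summable_of_ne_finset_zero (s := {n}) fun k hk => by
        simp [Finset.notMem_singleton.1 hk]
    obtain ⟨x, hx, -⟩ := hadm₁' _ (hsum β)
    have hx' : IsWeightedSolution A Z (fun k => μ k ^ (-β)) (Pi.single n v) x := by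
      obtain ⟨C, hC⟩ := hx.bounded
      refine ⟨hx.zero_mem, ⟨μ 0 ^ (-β) * μ 0 ^ (-β) * C, fun k => ?_⟩, hx.eq⟩
      calc μ k ^ (-β) * ‖x k‖ = μ k ^ (-β) * μ k ^ (-β) * (μ k ^ β * ‖x k‖) := by
            have := (hpow β k).ne'
            rw [Real.rpow_neg (hμpos k).le]
            field_simp
        _ ≤ μ 0 ^ (-β) * μ 0 ^ (-β) * C :=
            mul_le_mul (mul_le_mul (hanti k) (hanti k) (hpow _ _).le (hpow _ _).le) (hC k)
              (mul_nonneg (hpow _ _).le (norm_nonneg _)) (mul_pos (hpow _ _) (hpow _ _)).le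
    have hxz : x = z := (hadm₂' _ (hsum (-β))).unique hx' hz
    have hle := hbound n v x hx m
    rw [hxz] at hle
    simp only [z, hm, if_true] at hle
    rw [hdiv]
    have hm0 := hpow β m
    calc ‖𝒜 m (n + 1) v‖ = μ m ^ β * ‖𝒜 m (n + 1) v‖ / μ m ^ β := by field_simp
      _ ≤ K * (μ (n + 1) ^ β * ν (n + 1) * ‖v‖) / μ m ^ β := by gcongr
      _ = K * (μ (n + 1) ^ β / μ m ^ β) * ν (n + 1) * ‖v‖ := by ring
  have hfac : ∀ m, 1 ≤ m → 𝒜 m 0 = (𝒜 m 1).comp (A 0) := by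
    intro m hm
    induction m, hm using Nat.le_induction with
    | base =>
      ext v
      simp [h𝒜succ 0 0 le_rfl, h𝒜id]
    | succ k hk ih =>
      rw [h𝒜succ k 0 (Nat.zero_le k), ih, h𝒜succ k 1 hk, ContinuousLinearMap.comp_assoc]
  let D : ℝ := K * (μ 1 ^ β / μ 0 ^ β) * ν 1 * ‖A 0‖
  have hD : 0 ≤ D := mul_nonneg (mul_nonneg (mul_nonneg hK
    (div_pos (hpow β 1) (hpow β 0)).le) (hνpos 1).le) (norm_nonneg _)
  refine ⟨1 + K + D, by linarith, fun m n hmn v hv => ?_⟩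
  have hmono : ∀ c ≤ 1 + K + D, c * (μ m / μ n) ^ (-β) * ν n * ‖v‖ ≤
      (1 + K + D) * (μ m / μ n) ^ (-β) * ν n * ‖v‖ := by
    intro c hc
    have h1 := (Real.rpow_pos_of_pos (div_pos (hμpos m) (hμpos n)) (-β)).le
    have h2 := (hνpos n).le
    gcongr
  rcases n with _ | n
  · rcases m with _ | m
    · refine le_trans ?_ (hmono 1 (by linarith))
      rw [h𝒜id, div_self (hμpos 0).ne', Real.one_rpow, one_mul, one_mul]
      exact le_mul_of_one_le_left (norm_nonneg v) (hν 0)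
    · refine le_trans ?_ (hmono D (by linarith))
      obtain ⟨C', hC'⟩ := hv
      have h1 := hsucc (m + 1) 0 (by omega) (A 0 v) ⟨C', fun k hk => by
        simpa [hfac k hk] using hC' k (Nat.zero_le k)⟩
      rw [hfac _ (by omega), ContinuousLinearMap.comp_apply]
      refine h1.trans ?_
      rw [hdiv, hdiv]
      have hp0 := hpow β 0
      have hp1 := hpow β 1
      have hpm := hpow β (m + 1)
      have hν1 := hνpos 1
      calc K * (μ (0 + 1) ^ β / μ (m + 1) ^ β) * ν (0 + 1) * ‖A 0 v‖
          ≤ K * (μ 1 ^ β / μ (m + 1) ^ β) * ν 1 * (‖A 0‖ * ‖v‖) := by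
            simp only [zero_add]
            gcongr
            exact (A 0).le_opNorm v
        _ = D * (μ 0 ^ β / μ (m + 1) ^ β) * 1 * ‖v‖ := by
            simp only [D]
            field_simp
        _ ≤ D * (μ 0 ^ β / μ (m + 1) ^ β) * ν 0 * ‖v‖ := by
            gcongr
            exact hν 0
  · exact (hsucc m n hmn v hv).trans (hmono K (by linarith))
end
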